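/- Let δ ≥ 1 be an integer, T > 0 and C₀ > 0. Let h_n, h : ℝ → ℝ (n ≥ 1) be measurable functions such that: (a) for every M > 0, sup_{|r| ≤ M} |h_n(r) − h(r)| → 0 as n → ∞; (b) |h_n(r)| + |h(r)| ≤ C₀(|r| + |r|^{δ+1} + |r|^{2δ+1}) for all r ∈ ℝ and all n; (c) |h(r) − h(q)| ≤ C₀(1 + |r|^δ + |q|^δ + |r|^{2δ} + |q|^{2δ}) |r − q| for all r, q ∈ ℝ. Let u_n, u : [0,T]×[0,1] → ℝ be jointly measurable functions such that ∫₀ᵀ∫₀¹ |u_n(t,x) − u(t,x)|² dx dt → 0 as n → ∞, sup_n ∫₀ᵀ∫₀¹ |u_n(t,x)|^{2(δ+1)} dx dt < ∞, and ∫₀ᵀ∫₀¹ |u(t,x)|^{2(δ+1)} dx dt < ∞. Then ∫₀ᵀ∫₀¹ |h_n(u_n(t,x)) − h(u(t,x))| dx dt → 0 as n → ∞. -/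

import Mathlib

open MeasureTheory Set Filter
open scoped ENNReal

/-- Polynomial growth plus locally uniform convergence and a local Lipschitz bound control
`|hn n r - h q|` by a small multiple of `1 + |r| ^ p + |q| ^ p` plus a multiple of `(r - q) ^ 2`. -/
theorem exists_abs_sub_le_mul_add_mul_sq (δ : ℕ) {C₀ : ℝ} (hC₀ : 0 < C₀)
    (hn : ℕ → ℝ → ℝ) (h : ℝ → ℝ)
    (ha : ∀ M > (0:ℝ), ∀ ε > (0:ℝ), ∃ N : ℕ, ∀ n ≥ N, ∀ r : ℝ, |r| ≤ M →
      |hn n r - h r| ≤ ε)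
    (hb : ∀ n, ∀ r : ℝ,
      |hn n r| + |h r| ≤ C₀ * (|r| + |r| ^ (δ + 1) + |r| ^ (2 * δ + 1)))
    (hc : ∀ r q : ℝ,
      |h r - h q| ≤ C₀ * (1 + |r| ^ δ + |q| ^ δ + |r| ^ (2 * δ) + |q| ^ (2 * δ)) * |r - q|)
    {ε : ℝ} (hε : 0 < ε) :
    ∃ c : ℝ, 0 ≤ c ∧ ∃ N : ℕ, ∀ n ≥ N, ∀ r q : ℝ,
      |hn n r - h q| ≤
        ε * (1 + |r| ^ (2 * (δ + 1)) + |q| ^ (2 * (δ + 1))) + c * (r - q) ^ 2 := by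
  set M : ℝ := 6 * C₀ / ε + 1 with hM
  have hM0 : 0 < M := by positivity
  have hMε : 6 * C₀ ≤ ε * M := by
    have : ε * M = 6 * C₀ + ε := by rw [hM]; field_simp
    linarith
  set K : ℝ := 5 * C₀ * M ^ (2 * δ) with hK
  obtain ⟨N, hN⟩ := ha M hM0 (ε / 2) (half_pos hε)
  refine ⟨K ^ 2 / (2 * ε), by positivity, N, fun n hnN r q => ?_⟩
  set X : ℝ := max 1 (max |r| |q|) with hX
  have hX1 : 1 ≤ X := le_max_left _ _
  have hrX : |r| ≤ X := (le_max_left _ _).trans (le_max_right _ _)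
  have hqX : |q| ≤ X := (le_max_right _ _).trans (le_max_right _ _)
  have hr0 : 0 ≤ |r| ^ (2 * (δ + 1)) := by positivity
  have hq0 : 0 ≤ |q| ^ (2 * (δ + 1)) := by positivity
  have hpow : ∀ y : ℝ, |y| ≤ X → ∀ k m : ℕ, k ≤ m → |y| ^ k ≤ X ^ m := fun y hy k m hkm =>
    (pow_le_pow_left₀ (abs_nonneg y) hy k).trans (pow_le_pow_right₀ hX1 hkm)
  rcases le_or_gt X M with hXM | hXM
  · have h1 : |hn n r - h r| ≤ ε / 2 := hN n hnN r (hrX.trans hXM)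
    have h2 : |h r - h q| ≤ K * |r - q| := by
      refine (hc r q).trans (mul_le_mul_of_nonneg_right ?_ (abs_nonneg _))
      have hXp : X ^ (2 * δ) ≤ M ^ (2 * δ) := pow_le_pow_left₀ (by linarith) hXM _
      have e0 : 1 ≤ X ^ (2 * δ) := one_le_pow₀ hX1
      have e1 := hpow r hrX δ (2 * δ) (by omega)
      have e2 := hpow q hqX δ (2 * δ) (by omega)
      have e3 := hpow r hrX (2 * δ) (2 * δ) le_rfl
      have e4 := hpow q hqX (2 * δ) (2 * δ) le_rfl
      calc C₀ * (1 + |r| ^ δ + |q| ^ δ + |r| ^ (2 * δ) + |q| ^ (2 * δ))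
          ≤ C₀ * (5 * M ^ (2 * δ)) := mul_le_mul_of_nonneg_left (by linarith) hC₀.le
        _ = K := by rw [hK]; ring
    have h3 : K * |r - q| ≤ ε / 2 + K ^ 2 / (2 * ε) * (r - q) ^ 2 := by
      have e : ε / 2 + K ^ 2 / (2 * ε) * (r - q) ^ 2 - K * |r - q|
          = (ε - K * |r - q|) ^ 2 / (2 * ε) := by
        rw [← sq_abs (r - q)]; field_simp; ring
      have : 0 ≤ (ε - K * |r - q|) ^ 2 / (2 * ε) := by positivity
      linarith
    have h4 := abs_sub_le (hn n r) (h r) (h q)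
    nlinarith [mul_nonneg hε.le hr0, mul_nonneg hε.le hq0]
  · have hgrow : ∀ y : ℝ, |y| ≤ X → |hn n y| + |h y| ≤ 3 * C₀ * X ^ (2 * δ + 1) := by
      intro y hy
      have e1 := hpow y hy 1 (2 * δ + 1) (by omega)
      have e2 := hpow y hy (δ + 1) (2 * δ + 1) (by omega)
      have e3 := hpow y hy (2 * δ + 1) (2 * δ + 1) le_rfl
      rw [pow_one] at e1
      calc |hn n y| + |h y| ≤ C₀ * (|y| + |y| ^ (δ + 1) + |y| ^ (2 * δ + 1)) := hb n y
        _ ≤ C₀ * (3 * X ^ (2 * δ + 1)) := mul_le_mul_of_nonneg_left (by linarith) hC₀.le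
        _ = 3 * C₀ * X ^ (2 * δ + 1) := by ring
    have h1 := hgrow r hrX
    have h2 := hgrow q hqX
    have h3 : 6 * C₀ * X ^ (2 * δ + 1) ≤ ε * X ^ (2 * (δ + 1)) := by
      have e : ε * X ^ (2 * (δ + 1)) = ε * X * X ^ (2 * δ + 1) := by ring
      rw [e]
      refine mul_le_mul_of_nonneg_right (hMε.trans ?_) (by positivity)
      exact mul_le_mul_of_nonneg_left hXM.le hε.le
    have h4 : X ^ (2 * (δ + 1)) ≤ 1 + |r| ^ (2 * (δ + 1)) + |q| ^ (2 * (δ + 1)) := by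
      rcases max_choice 1 (max |r| |q|) with e | e
      · rw [hX, e, one_pow]; linarith
      · rcases max_choice |r| |q| with e' | e' <;> rw [hX, e, e'] <;> linarith
    have h5 : 0 ≤ K ^ 2 / (2 * ε) * (r - q) ^ 2 := by positivity
    have h6 := mul_le_mul_of_nonneg_left h4 hε.le
    have h7 := abs_sub (hn n r) (h q)
    have h8 := abs_nonneg (h r)
    have h9 := abs_nonneg (hn n q)
    linarith

theorem statement17 (δ : ℕ) (hδ : 1 ≤ δ) (T C₀ : ℝ) (hT : 0 < T) (hC₀ : 0 < C₀)
    (hn : ℕ → ℝ → ℝ) (h : ℝ → ℝ)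
    (hnmeas : ∀ n, Measurable (hn n)) (hmeas : Measurable h)
    (ha : ∀ M > (0:ℝ), ∀ ε > (0:ℝ), ∃ N : ℕ, ∀ n ≥ N, ∀ r : ℝ, |r| ≤ M →
      |hn n r - h r| ≤ ε)
    (hb : ∀ n, ∀ r : ℝ,
      |hn n r| + |h r| ≤ C₀ * (|r| + |r| ^ (δ + 1) + |r| ^ (2 * δ + 1)))
    (hc : ∀ r q : ℝ,
      |h r - h q| ≤ C₀ * (1 + |r| ^ δ + |q| ^ δ + |r| ^ (2 * δ) + |q| ^ (2 * δ)) * |r - q|)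
    (u : ℝ → ℝ → ℝ) (un : ℕ → ℝ → ℝ → ℝ)
    (humeas : Measurable fun q : ℝ × ℝ => u q.1 q.2)
    (hunmeas : ∀ n, Measurable fun q : ℝ × ℝ => un n q.1 q.2)
    (hconv : Tendsto (fun n => ∫⁻ q in (Ioo (0:ℝ) T) ×ˢ (Ioo (0:ℝ) 1),
        ENNReal.ofReal ((un n q.1 q.2 - u q.1 q.2) ^ 2)) atTop (nhds 0))
    (hbound : ∃ B : ℝ≥0∞, B < ⊤ ∧ ∀ n,
      (∫⁻ q in (Ioo (0:ℝ) T) ×ˢ (Ioo (0:ℝ) 1),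
        ENNReal.ofReal (|un n q.1 q.2| ^ (2 * (δ + 1)))) ≤ B)
    (hu : (∫⁻ q in (Ioo (0:ℝ) T) ×ˢ (Ioo (0:ℝ) 1),
        ENNReal.ofReal (|u q.1 q.2| ^ (2 * (δ + 1)))) < ⊤) :
    Tendsto (fun n => ∫⁻ q in (Ioo (0:ℝ) T) ×ˢ (Ioo (0:ℝ) 1),
      ENNReal.ofReal (|hn n (un n q.1 q.2) - h (u q.1 q.2)|)) atTop (nhds 0) := by
  obtain ⟨B, hB, hunB⟩ := hbound
  set μ : Measure (ℝ × ℝ) := volume.restrict ((Ioo (0:ℝ) T) ×ˢ (Ioo (0:ℝ) 1)) with hμ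
  set U : ℝ≥0∞ := ∫⁻ q, ENNReal.ofReal (|u q.1 q.2| ^ (2 * (δ + 1))) ∂μ
  have hμfin : μ univ ≠ ⊤ := by
    rw [hμ, Measure.restrict_apply_univ, Measure.volume_eq_prod, Measure.prod_prod,
      Real.volume_Ioo, Real.volume_Ioo]
    exact ENNReal.mul_ne_top ENNReal.ofReal_ne_top ENNReal.ofReal_ne_top
  have hA : μ univ + B + U ≠ ⊤ :=
    ENNReal.add_ne_top.2 ⟨ENNReal.add_ne_top.2 ⟨hμfin, hB.ne⟩, hu.ne⟩
  rw [ENNReal.tendsto_nhds_zero]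
  intro e he
  have he2 : e / 2 ≠ 0 := (ENNReal.half_pos he.ne').ne'
  obtain ⟨ε, hε, hεA⟩ := ENNReal.exists_nnreal_pos_mul_lt hA he2
  obtain ⟨c, hc0, N, hN⟩ :=
    exists_abs_sub_le_mul_add_mul_sq δ hC₀ hn h ha hb hc (ε := ε) (by exact_mod_cast hε)
  have hlim := ENNReal.Tendsto.const_mul hconv (a := ENNReal.ofReal c)
    (Or.inr ENNReal.ofReal_ne_top)
  rw [mul_zero, ENNReal.tendsto_nhds_zero] at hlim
  filter_upwards [hlim (e / 2) (pos_iff_ne_zero.2 he2), eventually_ge_atTop N] with n hn1 hnN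
  have hm1 : Measurable fun q : ℝ × ℝ => ENNReal.ofReal (|un n q.1 q.2| ^ (2 * (δ + 1))) :=
    ((hunmeas n).abs.pow_const _).ennreal_ofReal
  have hm2 : Measurable fun q : ℝ × ℝ => ENNReal.ofReal (|u q.1 q.2| ^ (2 * (δ + 1))) :=
    (humeas.abs.pow_const _).ennreal_ofReal
  have hm3 : Measurable fun q : ℝ × ℝ => ENNReal.ofReal ((un n q.1 q.2 - u q.1 q.2) ^ 2) :=
    (((hunmeas n).sub humeas).pow_const _).ennreal_ofReal
  calc ∫⁻ q, ENNReal.ofReal (|hn n (un n q.1 q.2) - h (u q.1 q.2)|) ∂μ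
      ≤ ∫⁻ q, ((ε : ℝ≥0∞) * (1 + ENNReal.ofReal (|un n q.1 q.2| ^ (2 * (δ + 1)))
          + ENNReal.ofReal (|u q.1 q.2| ^ (2 * (δ + 1))))
          + ENNReal.ofReal c * ENNReal.ofReal ((un n q.1 q.2 - u q.1 q.2) ^ 2)) ∂μ := by
        refine lintegral_mono fun q => ?_
        refine (ENNReal.ofReal_le_ofReal (hN n hnN (un n q.1 q.2) (u q.1 q.2))).trans_eq ?_
        rw [ENNReal.ofReal_add (by positivity) (by positivity), ENNReal.ofReal_mul (by positivity),
          ENNReal.ofReal_mul hc0, ENNReal.ofReal_add (by positivity) (by positivity),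
          ENNReal.ofReal_add (by positivity) (by positivity), ENNReal.ofReal_one,
          ENNReal.ofReal_coe_nnreal]
    _ = ε * (μ univ + (∫⁻ q, ENNReal.ofReal (|un n q.1 q.2| ^ (2 * (δ + 1))) ∂μ) + U)
          + ENNReal.ofReal c
            * ∫⁻ q, ENNReal.ofReal ((un n q.1 q.2 - u q.1 q.2) ^ 2) ∂μ := by
        rw [lintegral_add_right _ (hm3.const_mul _), lintegral_const_mul _ hm3,
          lintegral_const_mul' _ _ ENNReal.coe_ne_top, lintegral_add_right _ hm2,
          lintegral_add_right _ hm1, lintegral_one]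
    _ ≤ ε * (μ univ + B + U) + e / 2 := by
        gcongr
        exact hunB n
    _ ≤ e / 2 + e / 2 := by gcongr
    _ = e := ENNReal.add_halves e
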